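/- Let R = ℚ[a₂, a₃, p₀, p₁] be the polynomial ring over ℚ in four indeterminates, let B = R[x]/(x³ + a₂x + a₃), free as an R-module with basis 1, x, x², and let π_! : B → R take the coefficient of x² in this basis. Set P = 3x² + p₁·x + p₀ and E = 3x² + a₂ in B, and define pd₀ = −2a₂ − p₀, pd₁ = −p₁, and κ_{L₂} = (1/45)·(7·π_!(E²) − π_!(P²)) in R. Then: 21·pd₀ = 4·π_!(P²) − 7·π_!(E·P) + 180·κ_{L₂}, and 45·κ_{L₂} = 6·pd₀ − pd₁². -/

import Mathlib

/-!
Statement 15: with R = ℚ[a₂,a₃,p₀,p₁], B = R[x]/(x³ + a₂x + a₃), π_! the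
coefficient of x², P = 3x² + p₁x + p₀, E = 3x² + a₂, pd₀ = −2a₂ − p₀,
pd₁ = −p₁ and κ_{L₂} = (1/45)(7π_!(E²) − π_!(P²)), one has
21·pd₀ = 4·π_!(P²) − 7·π_!(E·P) + 180·κ_{L₂} and 45·κ_{L₂} = 6·pd₀ − pd₁².

Variables of `MvPolynomial (Fin 4) ℚ`: 0 = a₂, 1 = a₃, 2 = p₀, 3 = p₁.
-/

noncomputable section

open Polynomial

/-- R = ℚ[a₂, a₃, p₀, p₁]. -/
abbrev RRing : Type := MvPolynomial (Fin 4) ℚ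

/-- a₂. -/ def ra2 : RRing := MvPolynomial.X 0
/-- a₃. -/ def ra3 : RRing := MvPolynomial.X 1
/-- p₀. -/ def rp0 : RRing := MvPolynomial.X 2
/-- p₁. -/ def rp1 : RRing := MvPolynomial.X 3

/-- The monic polynomial x³ + a₂x + a₃. -/
def cubic : Polynomial RRing := X ^ 3 + C ra2 * X + C ra3

/-- π_! : B = R[x]/(x³ + a₂x + a₃) → R, extracting the coefficient of x² in the
basis 1, x, x²; computed on the canonical representative modulo the monic cubic. -/
def piShriek (g : Polynomial RRing) : RRing := (g %ₘ cubic).coeff 2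

/-- P = 3x² + p₁·x + p₀. -/
def Pcl : Polynomial RRing := 3 * X ^ 2 + C rp1 * X + C rp0

/-- E = 3x² + a₂. -/
def Ecl : Polynomial RRing := 3 * X ^ 2 + C ra2

/-- pd₀ = −2a₂ − p₀. -/
def pd0 : RRing := -2 * ra2 - rp0

/-- pd₁ = −p₁. -/
def pd1 : RRing := -rp1

/-- κ_{L₂} = (1/45)·(7·π_!(E²) − π_!(P²)). -/
def kappaL2 : RRing :=
  MvPolynomial.C ((45 : ℚ)⁻¹) * (7 * piShriek (Ecl ^ 2) - piShriek (Pcl ^ 2))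

theorem cubic_natDegree : cubic.natDegree = 3 := by
  unfold cubic
  compute_degree!

theorem cubic_monic : cubic.Monic := by
  unfold cubic
  monicity!

theorem piShriek_cubic_mul_add_quadratic (q : Polynomial RRing) (a b c : RRing) :
    piShriek (cubic * q + (C a * X ^ 2 + C b * X + C c)) = a := by
  have hdeg : (C a * X ^ 2 + C b * X + C c).degree < cubic.degree := by
    rw [degree_eq_natDegree cubic_monic.ne_zero, cubic_natDegree]
    exact degree_quadratic_lt
  have h := (div_modByMonic_unique q _ cubic_monic ⟨add_comm _ (cubic * q), hdeg⟩).2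
  simp [piShriek, h]

theorem piShriek_quadratic_mul_quadratic (a b c d e f : RRing) :
    piShriek ((C a * X ^ 2 + C b * X + C c) * (C d * X ^ 2 + C e * X + C f)) =
      a * f + b * e + c * d - ra2 * (a * d) := by
  rw [← piShriek_cubic_mul_add_quadratic (C (a * d) * X + C (a * e + b * d))
    (a * f + b * e + c * d - ra2 * (a * d))
    (b * f + c * e - ra3 * (a * d) - ra2 * (a * e + b * d))
    (c * f - ra3 * (a * e + b * d))]
  congr 1
  simp only [cubic, map_add, map_sub, map_mul]
  ring

theorem Pcl_eq : Pcl = C 3 * X ^ 2 + C rp1 * X + C rp0 := by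
  simp only [Pcl, map_ofNat]

theorem Ecl_eq : Ecl = C 3 * X ^ 2 + C 0 * X + C ra2 := by
  simp only [Ecl, map_ofNat, map_zero, zero_mul, add_zero]

theorem forty_five_mul_kappaL2 :
    45 * kappaL2 = 7 * piShriek (Ecl ^ 2) - piShriek (Pcl ^ 2) := by
  have h : (45 : RRing) * MvPolynomial.C ((45 : ℚ)⁻¹) = 1 := by
    rw [← map_ofNat (MvPolynomial.C (σ := Fin 4) (R := ℚ)) 45, ← map_mul]
    norm_num
  rw [kappaL2, ← mul_assoc, h, one_mul]

theorem stmt15 :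
    21 * pd0 = 4 * piShriek (Pcl ^ 2) - 7 * piShriek (Ecl * Pcl) + 180 * kappaL2 ∧
    45 * kappaL2 = 6 * pd0 - pd1 ^ 2 := by
  have hκ := forty_five_mul_kappaL2
  rw [sq Ecl, sq Pcl, Ecl_eq, Pcl_eq] at hκ
  rw [sq Pcl, Ecl_eq, Pcl_eq]
  simp only [piShriek_quadratic_mul_quadratic] at hκ ⊢
  simp only [pd0, pd1]
  constructor
  · linear_combination -4 * hκ
  · linear_combination hκ

end
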